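/- (Marginal–residual bijection.) For every subset γ ⊆ {1,…,d}, the linear map T_γ sending a marginal vector μ to the family of its residuals (T_{τ,γ} μ)_{τ ⊆ γ} is an invertible linear transformation, with inverse given by (z_τ)_{τ ⊆ γ} ↦ ∑_{τ ⊆ γ} T⁺_{τ,γ} z_τ. Precisely: (i) for every μ, ∑_{τ ⊆ γ} T⁺_{τ,γ} (T_{τ,γ} μ) = μ; and (ii) for every family of vectors (z_τ)_{τ ⊆ γ} and every α ⊆ γ, T_{α,γ} (∑_{τ ⊆ γ} T⁺_{τ,γ} z_τ) = z_α. -/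

import Mathlib

open Matrix Finset

/-- Entry of the subtraction matrix `S_ℓ` (0-indexed):
column `0` gives `-1`, column `i+1` gives `1`, all other entries `0`. -/
def sEnt (i j : ℕ) : ℝ := if j = 0 then -1 else if j = i + 1 then 1 else 0

/-- Entry of `S⁺_ℓ`: a zero row stacked on `I_{ℓ-1}`, minus `1/ℓ` everywhere. -/
noncomputable def spEnt (ℓ i j : ℕ) : ℝ :=
  (if i = j + 1 then (1 : ℝ) else 0) - (ℓ : ℝ)⁻¹

/-- Residual index sizes: `n k − 1` for `k ∈ τ`, and `1` otherwise. -/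
def rIdx {d : ℕ} (n : Fin d → ℕ) (τ : Finset (Fin d)) (k : Fin d) : ℕ :=
  if k ∈ τ then n k - 1 else 1

/-- Marginal index sizes: `n k` for `k ∈ γ`, and `1` otherwise. -/
def mIdx {d : ℕ} (n : Fin d → ℕ) (γ : Finset (Fin d)) (k : Fin d) : ℕ :=
  if k ∈ γ then n k else 1

/-- The decomposition matrix `T_{τ,γ} = ⊠_k C_k` with `C_k = S_{n_k}` for
`k ∈ τ`, `C_k = 1ᵀ_{n_k}` (all-ones row) for `k ∈ γ∖τ`, and `C_k = [1]`
for `k ∉ γ`, realized entrywise via the tensor (Kronecker) product. -/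
def Tmat {d : ℕ} (n : Fin d → ℕ) (τ γ : Finset (Fin d)) :
    Matrix (∀ k, Fin (rIdx n τ k)) (∀ k, Fin (mIdx n γ k)) ℝ :=
  Matrix.of fun i j => ∏ k, if k ∈ τ then sEnt (i k) (j k) else (1 : ℝ)

/-- The matrix `T⁺_{τ,γ} = ⊠_k D_k` with `D_k = S⁺_{n_k}` for `k ∈ τ`,
`D_k = (1/n_k)·1_{n_k}` (constant column) for `k ∈ γ∖τ`, and `D_k = [1]`
for `k ∉ γ`. -/
noncomputable def Tpinv {d : ℕ} (n : Fin d → ℕ) (τ γ : Finset (Fin d)) :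
    Matrix (∀ k, Fin (mIdx n γ k)) (∀ k, Fin (rIdx n τ k)) ℝ :=
  Matrix.of fun i j => ∏ k,
    if k ∈ τ then spEnt (n k) (i k) (j k)
    else if k ∈ γ then ((n k : ℝ))⁻¹ else (1 : ℝ)

/-- The marginal query matrix `M_γ = ⊠_k E_k` with `E_k = I_{n_k}` for
`k ∈ γ` and `E_k = 1ᵀ_{n_k}` otherwise. -/
def Mmat {d : ℕ} (n : Fin d → ℕ) (γ : Finset (Fin d)) :
    Matrix (∀ k, Fin (mIdx n γ k)) (∀ k, Fin (n k)) ℝ :=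
  Matrix.of fun i j => ∏ k,
    if k ∈ γ then (if (i k : ℕ) = (j k : ℕ) then (1 : ℝ) else 0) else (1 : ℝ)

/-- The residual query matrix `R_τ = ⊠_k F_k` with `F_k = S_{n_k}` for
`k ∈ τ` and `F_k = 1ᵀ_{n_k}` otherwise. -/
def Rmat {d : ℕ} (n : Fin d → ℕ) (τ : Finset (Fin d)) :
    Matrix (∀ k, Fin (rIdx n τ k)) (∀ k, Fin (n k)) ℝ :=
  Matrix.of fun i j => ∏ k, if k ∈ τ then sEnt (i k) (j k) else (1 : ℝ)

/-- Pairing a row of the subtraction matrix with `v` gives the difference `v (i + 1) - v 0`. -/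
theorem sum_sEnt_mul {m i : ℕ} (hi : i < m) (v : ℕ → ℝ) :
    ∑ l ∈ range (m + 1), sEnt i l * v l = v (i + 1) - v 0 := by
  rw [Finset.sum_range_succ']
  simp [sEnt, hi, sub_eq_add_neg]

theorem sum_spEnt {m j : ℕ} (hj : j < m) :
    ∑ l ∈ range (m + 1), spEnt (m + 1) l j = 0 := by
  have h : ((m : ℝ) + 1) ≠ 0 := by positivity
  simp [spEnt, Finset.sum_sub_distrib, hj, h]

/-- `S⁺ * S` is the identity minus the averaging projection. -/
theorem sum_spEnt_mul_sEnt {m i j : ℕ} (hi : i < m + 1) (hj : j < m + 1) :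
    ∑ l ∈ range m, spEnt (m + 1) i l * sEnt l j
      = (if i = j then 1 else 0) - (((m + 1 : ℕ) : ℝ))⁻¹ := by
  have h : ((m : ℝ) + 1) ≠ 0 := by positivity
  rcases j with _ | j
  · rcases i with _ | i
    · simp [spEnt, sEnt]
      field_simp
      ring
    · have hi' : i < m := by lia
      simp [spEnt, sEnt, hi']
      field_simp
      ring
  · have hj' : j < m := by lia
    simp [spEnt, sEnt, hj']

/-- The product of two tensor-product matrices is computed factor by factor. -/
theorem tensor_mul_tensor {ι : Type*} [Fintype ι] [DecidableEq ι] {α β γ : ι → Type*}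
    [∀ k, Fintype (β k)]
    (A : ∀ k, α k → β k → ℝ) (B : ∀ k, β k → γ k → ℝ) (i : ∀ k, α k) (j : ∀ k, γ k) :
    ((Matrix.of fun (i : ∀ k, α k) (l : ∀ k, β k) => ∏ k, A k (i k) (l k)) *
      (Matrix.of fun (l : ∀ k, β k) (j : ∀ k, γ k) => ∏ k, B k (l k) (j k))) i j
      = ∏ k, ∑ l, A k (i k) l * B k l (j k) := by
  rw [Finset.prod_univ_sum, Fintype.piFinset_univ, Matrix.mul_apply]
  simp [Finset.prod_mul_distrib]

theorem prod_ite_val_eq {d : ℕ} {s : Fin d → ℕ} (i j : ∀ k, Fin (s k)) :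
    (∏ k, if (i k : ℕ) = j k then (1 : ℝ) else 0) = (1 : Matrix _ _ ℝ) i j := by
  rw [Finset.prod_ite_zero, Matrix.one_apply]
  simp [funext_iff, Fin.ext_iff]

theorem Tpinv_mul_Tmat_apply {d : ℕ} {n : Fin d → ℕ} (hn : ∀ k, 2 ≤ n k)
    {τ γ : Finset (Fin d)} (hτ : τ ⊆ γ) (i j : ∀ k, Fin (mIdx n γ k)) :
    (Tpinv n τ γ * Tmat n τ γ) i j
      = (∏ k ∈ τ, ((if (i k : ℕ) = j k then (1 : ℝ) else 0) - (n k : ℝ)⁻¹)) *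
        ∏ k ∈ γ \ τ, (n k : ℝ)⁻¹ := by
  have hfactor : ∀ k, (∑ l : Fin (rIdx n τ k),
      (if k ∈ τ then spEnt (n k) (i k) l else if k ∈ γ then ((n k : ℝ))⁻¹ else (1 : ℝ)) *
        (if k ∈ τ then sEnt l (j k) else (1 : ℝ)))
      = (if k ∈ τ then (if (i k : ℕ) = j k then (1 : ℝ) else 0) - (n k : ℝ)⁻¹ else 1) *
        (if k ∈ γ \ τ then (n k : ℝ)⁻¹ else 1) := by
    intro k
    rw [Fin.sum_univ_eq_sum_range (fun l : ℕ =>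
      (if k ∈ τ then spEnt (n k) (i k) l else if k ∈ γ then ((n k : ℝ))⁻¹ else (1 : ℝ)) *
      (if k ∈ τ then sEnt l (j k) else (1 : ℝ)))]
    by_cases hk : k ∈ τ
    · obtain ⟨m, hm⟩ : ∃ m, n k = m + 1 := ⟨n k - 1, by have := hn k; lia⟩
      have hmIdx : mIdx n γ k = m + 1 := by simp [mIdx, hτ hk, hm]
      simpa [rIdx, hk, hm] using
        sum_spEnt_mul_sEnt ((i k).isLt.trans_eq hmIdx) ((j k).isLt.trans_eq hmIdx)
    · simp [rIdx, hk]
  refine (tensor_mul_tensor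
    (fun k (a : Fin (mIdx n γ k)) (b : Fin (rIdx n τ k)) =>
      if k ∈ τ then spEnt (n k) a b else if k ∈ γ then ((n k : ℝ))⁻¹ else (1 : ℝ))
    (fun k (a : Fin (rIdx n τ k)) (b : Fin (mIdx n γ k)) =>
      if k ∈ τ then sEnt a b else (1 : ℝ)) i j).trans ?_
  simp only [hfactor, Finset.prod_mul_distrib, Finset.prod_ite_mem, Finset.univ_inter]

theorem sum_Tpinv_mul_Tmat {d : ℕ} {n : Fin d → ℕ} (hn : ∀ k, 2 ≤ n k)
    (γ : Finset (Fin d)) :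
    ∑ τ ∈ γ.powerset, Tpinv n τ γ * Tmat n τ γ = 1 := by
  ext i j
  rw [Matrix.sum_apply, Finset.sum_congr rfl fun τ hτ =>
    Tpinv_mul_Tmat_apply hn (Finset.mem_powerset.1 hτ) i j, ← Finset.prod_add,
    ← prod_ite_val_eq]
  simp only [sub_add_cancel]
  refine Finset.prod_subset (Finset.subset_univ γ) fun k _ hk => if_pos ?_
  have hi := (i k).isLt
  have hj := (j k).isLt
  simp only [mIdx, hk, if_false] at hi hj
  lia

theorem Tmat_mul_Tpinv_apply {d : ℕ} (n : Fin d → ℕ) (α τ γ : Finset (Fin d))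
    (i : ∀ k, Fin (rIdx n α k)) (j : ∀ k, Fin (rIdx n τ k)) :
    (Tmat n α γ * Tpinv n τ γ) i j = ∏ k, ∑ l ∈ range (mIdx n γ k),
      (if k ∈ α then sEnt (i k) l else 1) *
        (if k ∈ τ then spEnt (n k) l (j k) else if k ∈ γ then ((n k : ℝ))⁻¹ else (1 : ℝ)) := by
  refine (tensor_mul_tensor
    (fun k (a : Fin (rIdx n α k)) (b : Fin (mIdx n γ k)) =>
      if k ∈ α then sEnt a b else (1 : ℝ))
    (fun k (a : Fin (mIdx n γ k)) (b : Fin (rIdx n τ k)) =>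
      if k ∈ τ then spEnt (n k) a b else if k ∈ γ then ((n k : ℝ))⁻¹ else (1 : ℝ))
    i j).trans ?_
  simp only [Finset.sum_range]

theorem Tmat_mul_Tpinv_of_ne {d : ℕ} {n : Fin d → ℕ} (hn : ∀ k, 2 ≤ n k)
    {α τ γ : Finset (Fin d)} (hα : α ⊆ γ) (hτ : τ ⊆ γ) (h : τ ≠ α) :
    Tmat n α γ * Tpinv n τ γ = 0 := by
  obtain ⟨k, hk⟩ : ∃ k, ¬(k ∈ τ ↔ k ∈ α) := by
    by_contra! hall
    exact h (Finset.ext hall)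
  ext i j
  rw [Tmat_mul_Tpinv_apply, Matrix.zero_apply]
  refine Finset.prod_eq_zero (Finset.mem_univ k) ?_
  obtain ⟨m, hm⟩ : ∃ m, n k = m + 1 := ⟨n k - 1, by have := hn k; lia⟩
  have hi := (i k).isLt
  have hj := (j k).isLt
  by_cases hkα : k ∈ α
  · have hkτ : k ∉ τ := by tauto
    simp only [rIdx, hkα, if_true, hm, Nat.add_sub_cancel] at hi
    simpa [hkα, hkτ, hα hkα, mIdx, hm] using
      sum_sEnt_mul hi fun _ => ((m + 1 : ℕ) : ℝ)⁻¹
  · have hkτ : k ∈ τ := by tauto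
    simp only [rIdx, hkτ, if_true, hm, Nat.add_sub_cancel] at hj
    simpa [hkα, hkτ, hτ hkτ, mIdx, hm] using sum_spEnt hj

theorem Tmat_mul_Tpinv_self {d : ℕ} {n : Fin d → ℕ} (hn : ∀ k, 2 ≤ n k)
    {α γ : Finset (Fin d)} (hα : α ⊆ γ) :
    Tmat n α γ * Tpinv n α γ = 1 := by
  ext i j
  rw [Tmat_mul_Tpinv_apply, ← prod_ite_val_eq]
  refine Finset.prod_congr rfl fun k _ => ?_
  obtain ⟨m, hm⟩ : ∃ m, n k = m + 1 := ⟨n k - 1, by have := hn k; lia⟩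
  have hi := (i k).isLt
  have hj := (j k).isLt
  by_cases hk : k ∈ α
  · simp only [rIdx, hk, if_true, hm, Nat.add_sub_cancel] at hi
    simp only [hk, hα hk, mIdx, hm, if_true]
    rw [sum_sEnt_mul hi]
    simp [spEnt]
  · simp only [rIdx, hk, if_false] at hi hj
    have hij : (i k : ℕ) = j k := by lia
    have hne : (m : ℝ) + 1 ≠ 0 := by positivity
    by_cases hkγ : k ∈ γ <;> simp [hk, hkγ, mIdx, hm, hij, hne]


/-- (Marginal–residual bijection.) For every `γ ⊆ {1,…,d}`, the linear map
`μ ↦ (T_{τ,γ} μ)_{τ ⊆ γ}` is invertible with inverse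
`(z_τ)_{τ ⊆ γ} ↦ ∑_{τ ⊆ γ} T⁺_{τ,γ} z_τ`:
(i) `∑_{τ ⊆ γ} T⁺_{τ,γ} (T_{τ,γ} μ) = μ` for every marginal vector `μ`; and
(ii) `T_{α,γ} (∑_{τ ⊆ γ} T⁺_{τ,γ} z_τ) = z_α` for every family `(z_τ)` and
every `α ⊆ γ`. -/
theorem marginal_residual_bijection (d : ℕ) (hd : 1 ≤ d) (n : Fin d → ℕ)
    (hn : ∀ k, 2 ≤ n k) (γ : Finset (Fin d)) :
    (∀ μ : (∀ k, Fin (mIdx n γ k)) → ℝ,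
      ∑ τ ∈ γ.powerset, Tpinv n τ γ *ᵥ (Tmat n τ γ *ᵥ μ) = μ) ∧
    (∀ z : (τ : Finset (Fin d)) → ((∀ k, Fin (rIdx n τ k)) → ℝ),
      ∀ α ∈ γ.powerset,
        Tmat n α γ *ᵥ (∑ τ ∈ γ.powerset, Tpinv n τ γ *ᵥ z τ) = z α) := by
  refine ⟨fun μ => ?_, fun z α hα => ?_⟩
  · simp only [Matrix.mulVec_mulVec]
    rw [← Matrix.sum_mulVec, sum_Tpinv_mul_Tmat hn, Matrix.one_mulVec]
  · rw [Matrix.mulVec_sum, Finset.sum_eq_single_of_mem α hα]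
    · rw [Matrix.mulVec_mulVec, Tmat_mul_Tpinv_self hn (Finset.mem_powerset.1 hα),
        Matrix.one_mulVec]
    · intro τ hτ h
      rw [Matrix.mulVec_mulVec, Tmat_mul_Tpinv_of_ne hn (Finset.mem_powerset.1 hα)
        (Finset.mem_powerset.1 hτ) h, Matrix.zero_mulVec]
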